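/- arXiv:1605.00589 — 3 statements merged into one kernel-verified Lean document; each statement's English description precedes it below -/
import Mathlib

section
/- Dispersive comparison for the hard-sphere flow (Lemma 3.2, forward-in-time form). Let (Z_s(·), {τ_1,…,τ_k}) be a hard-sphere trajectory of s particles of diameter ε on [0,T]. Then for every t ∈ [0,T], (1/2)∑_{i=1}^s |x_i(t)|² ≥ (1/2)∑_{i=1}^s |x_i(0) + v_i(0) t|²; that is, the moment of inertia along the hard-sphere flow dominates the moment of inertia of the corresponding free flow started from the same initial configuration. -/
open scoped InnerProductSpace BigOperators
open Filter

/-- A hard-sphere trajectory of `s` particles of diameter `ε` on `[0,T]`: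
continuous positions `x i`, right-continuous piecewise-constant velocities `v i`,
a finite set of collision times in `(0,T)`; particles keep mutual distance `≥ ε`;
between collisions each particle moves freely with its (constant) velocity; at each
collision time exactly one pair is at distance `ε`, the relative velocity of that pair
is incoming, and the velocities jump by the hard-sphere collision transform. -/
structure HardSphereTrajectory (d s : ℕ) (ε T : ℝ) where
  x : Fin s → ℝ → EuclideanSpace ℝ (Fin d)
  v : Fin s → ℝ → EuclideanSpace ℝ (Fin d)
  col : Finset ℝ
  col_mem : ∀ τ ∈ col, 0 < τ ∧ τ < T
  x_cont : ∀ i : Fin s, ContinuousOn (x i) (Set.Icc 0 T)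
  sep : ∀ t ∈ Set.Icc (0:ℝ) T, ∀ i j : Fin s, i < j → ε ≤ dist (x i t) (x j t)
  right_cont : ∀ i : Fin s, ∀ t ∈ Set.Ico (0:ℝ) T,
    Tendsto (v i) (nhdsWithin t (Set.Ici t)) (nhds (v i t))
  free : ∀ a b : ℝ, 0 ≤ a → b ≤ T → a < b → (∀ τ ∈ col, τ ∉ Set.Ioo a b) →
    ∀ i : Fin s,
      (∀ t ∈ Set.Ioo a b, ∀ t' ∈ Set.Ioo a b, v i t = v i t') ∧
      (∀ t ∈ Set.Ioo a b, HasDerivAt (x i) (v i t) t)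
  collision : ∀ τ ∈ col, ∃ i j : Fin s, i < j ∧
    dist (x i τ) (x j τ) = ε ∧
    (∀ k l : Fin s, k < l → dist (x k τ) (x l τ) = ε → k = i ∧ l = j) ∧
    ∃ vim vjm : EuclideanSpace ℝ (Fin d),
      Tendsto (v i) (nhdsWithin τ (Set.Iio τ)) (nhds vim) ∧
      Tendsto (v j) (nhdsWithin τ (Set.Iio τ)) (nhds vjm) ∧
      (∀ k : Fin s, k ≠ i → k ≠ j →
        Tendsto (v k) (nhdsWithin τ (Set.Iio τ)) (nhds (v k τ))) ∧
      ⟪ε⁻¹ • (x j τ - x i τ), vjm - vim⟫_ℝ < 0 ∧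
      v i τ = vim + ⟪ε⁻¹ • (x j τ - x i τ), vjm - vim⟫_ℝ • (ε⁻¹ • (x j τ - x i τ)) ∧
      v j τ = vjm - ⟪ε⁻¹ • (x j τ - x i τ), vjm - vim⟫_ℝ • (ε⁻¹ • (x j τ - x i τ))

namespace HardSphereTrajectory

variable {d s : ℕ} {ε T : ℝ} (Z : HardSphereTrajectory d s ε T)

/-- On a collision-free interval the velocity keeps its value at the left endpoint. -/
lemma velocity_eq_left {a b : ℝ} (ha : 0 ≤ a) (hb : b ≤ T) (hab : a < b)
    (hfree : ∀ τ ∈ Z.col, τ ∉ Set.Ioo a b) (i : Fin s) {t : ℝ} (ht : t ∈ Set.Ioo a b) :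
    Z.v i t = Z.v i a := by
  have hconst := (Z.free a b ha hb hab hfree i).1
  have hright : Tendsto (Z.v i) (nhdsWithin a (Set.Ioi a)) (nhds (Z.v i a)) :=
    (Z.right_cont i a ⟨ha, hab.trans_le hb⟩).mono_left
      (nhdsWithin_mono a Set.Ioi_subset_Ici_self)
  refine tendsto_nhds_unique (tendsto_const_nhds.congr' ?_) hright
  filter_upwards [Ioo_mem_nhdsGT hab] with r hr using hconst t ht r hr

/-- The left limit of the velocity at the end of a collision-free interval. -/
lemma tendsto_velocity_left {a b : ℝ} (ha : 0 ≤ a) (hb : b ≤ T) (hab : a < b)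
    (hfree : ∀ τ ∈ Z.col, τ ∉ Set.Ioo a b) (i : Fin s) :
    Tendsto (Z.v i) (nhdsWithin b (Set.Iio b)) (nhds (Z.v i a)) := by
  refine tendsto_const_nhds.congr' ?_
  filter_upwards [Ioo_mem_nhdsLT hab] with r hr
    using (Z.velocity_eq_left ha hb hab hfree i hr).symm

/-- Positions at the end of a collision-free interval are given by free transport. -/
lemma position_eq_free {a b : ℝ} (ha : 0 ≤ a) (hb : b ≤ T) (hab : a < b)
    (hfree : ∀ τ ∈ Z.col, τ ∉ Set.Ioo a b) (i : Fin s) :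
    Z.x i b = Z.x i a + (b - a) • Z.v i a := by
  have hcont : ContinuousOn (Z.x i) (Set.Icc a b) :=
    (Z.x_cont i).mono (Set.Icc_subset_Icc ha hb)
  have hderiv : ∀ t ∈ Set.Ioo a b, HasDerivAt (Z.x i) (Z.v i a) t := fun t ht => by
    rw [← Z.velocity_eq_left ha hb hab hfree i ht]
    exact (Z.free a b ha hb hab hfree i).2 t ht
  have hderiv_left : HasDerivWithinAt (Z.x i) (Z.v i a) (Set.Ici a) a := by
    refine hasDerivWithinAt_Ici_of_tendsto_deriv (s := Set.Ioo a b)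
      (fun t ht => (hderiv t ht).differentiableAt.differentiableWithinAt)
      ((hcont a (Set.left_mem_Icc.2 hab.le)).mono Set.Ioo_subset_Icc_self)
      (Ioo_mem_nhdsGT hab) (tendsto_const_nhds.congr' ?_)
    filter_upwards [Ioo_mem_nhdsGT hab] with t ht using (hderiv t ht).deriv.symm
  have hzero : ∀ t ∈ Set.Ico a b,
      HasDerivWithinAt (fun r => Z.x i r - (r - a) • Z.v i a) 0 (Set.Ici t) t := by
    intro t ht
    have hx : HasDerivWithinAt (Z.x i) (Z.v i a) (Set.Ici t) t := by
      rcases ht.1.eq_or_lt with rfl | h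
      · exact hderiv_left
      · exact (hderiv t ⟨h, ht.2⟩).hasDerivWithinAt
    have hlin : HasDerivWithinAt (fun r : ℝ => (r - a) • Z.v i a) (Z.v i a) (Set.Ici t) t := by
      simpa using (((hasDerivAt_id t).sub_const a).smul_const (Z.v i a)).hasDerivWithinAt
    exact (hx.fun_sub hlin).congr_deriv (sub_self _)
  have hconst : Z.x i b - (b - a) • Z.v i a = Z.x i a - (a - a) • Z.v i a :=
    constant_of_has_deriv_right_zero (hcont.sub (by fun_prop)) hzero b (Set.right_mem_Icc.2 hab.le)
  simp only [sub_self, zero_smul, sub_zero] at hconst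
  rw [← hconst]
  abel

/-- A collision at the end of a collision-free interval preserves the kinetic energy and does not
decrease the virial `∑ ⟪xₖ, vₖ⟫`. -/
lemma energy_eq_and_virial_le (hε : 0 < ε) {a b : ℝ} (ha : 0 ≤ a) (hab : a < b)
    (hfree : ∀ τ ∈ Z.col, τ ∉ Set.Ioo a b) (hb : b ∈ Z.col) :
    ∑ k, ‖Z.v k b‖ ^ 2 = ∑ k, ‖Z.v k a‖ ^ 2 ∧
      ∑ k, ⟪Z.x k b, Z.v k a⟫_ℝ ≤ ∑ k, ⟪Z.x k b, Z.v k b⟫_ℝ := by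
  have hleft := Z.tendsto_velocity_left ha (Z.col_mem b hb).2.le hab hfree
  obtain ⟨i, j, hij, hdist, -, vim, vjm, hi, hj, hother, hneg, hvi, hvj⟩ := Z.collision b hb
  obtain rfl := tendsto_nhds_unique hi (hleft i)
  obtain rfl := tendsto_nhds_unique hj (hleft j)
  have hk : ∀ k, k ≠ i ∧ k ≠ j → Z.v k b = Z.v k a := fun k hk =>
    tendsto_nhds_unique (hother k hk.1 hk.2) (hleft k)
  have hrel : Z.x j b - Z.x i b = ε • (ε⁻¹ • (Z.x j b - Z.x i b)) := by
    rw [smul_smul, mul_inv_cancel₀ hε.ne', one_smul]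
  have hunit : ‖ε⁻¹ • (Z.x j b - Z.x i b)‖ = 1 := by
    rw [norm_smul, ← dist_eq_norm, dist_comm, hdist, Real.norm_of_nonneg (by positivity),
      inv_mul_cancel₀ hε.ne']
  generalize ε⁻¹ • (Z.x j b - Z.x i b) = ω at *
  have hωω : ⟪ω, ω⟫_ℝ = 1 := by rw [real_inner_self_eq_norm_sq, hunit, one_pow]
  constructor
  · rw [← sub_eq_zero, ← Finset.sum_sub_distrib,
      Fintype.sum_eq_add i j hij.ne (fun k h => by rw [hk k h, sub_self]), hvi, hvj]
    simp only [← real_inner_self_eq_norm_sq, inner_add_left, inner_add_right, inner_sub_left,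
      inner_sub_right, real_inner_smul_left, real_inner_smul_right, hωω,
      real_inner_comm ω (Z.v i a), real_inner_comm ω (Z.v j a)]
    ring
  · rw [← sub_nonneg, ← Finset.sum_sub_distrib,
      Fintype.sum_eq_add i j hij.ne (fun k h => by rw [hk k h, sub_self]), hvi, hvj]
    have hxj : Z.x j b = Z.x i b + ε • ω := by rw [← hrel]; abel
    generalize ⟪ω, Z.v j a - Z.v i a⟫_ℝ = c at *
    have hjump : ⟪Z.x i b, Z.v i a + c • ω⟫_ℝ - ⟪Z.x i b, Z.v i a⟫_ℝ +
        (⟪Z.x j b, Z.v j a - c • ω⟫_ℝ - ⟪Z.x j b, Z.v j a⟫_ℝ) = -c * ε := by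
      rw [hxj]
      simp only [inner_add_left, inner_add_right, inner_sub_right, real_inner_smul_left,
        real_inner_smul_right, hωω]
      ring
    rw [hjump]
    exact mul_nonneg (neg_nonneg.2 hneg.le) hε.le

/-- Moment of inertia of a freely transported configuration. -/
lemma sum_norm_add_smul_sq {ι E : Type*} [Fintype ι] [NormedAddCommGroup E]
    [InnerProductSpace ℝ E] (x v : ι → E) (r : ℝ) :
    ∑ k, ‖x k + r • v k‖ ^ 2 =
      ∑ k, ‖x k‖ ^ 2 + 2 * r * ∑ k, ⟪x k, v k⟫_ℝ + r ^ 2 * ∑ k, ‖v k‖ ^ 2 := by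
  simp only [Finset.mul_sum, ← Finset.sum_add_distrib]
  refine Finset.sum_congr rfl fun k _ => ?_
  rw [norm_add_sq_real, real_inner_smul_right, norm_smul, mul_pow, Real.norm_eq_abs, sq_abs]
  ring

/-- The moment of inertia at time `t` dominates its free-flow value; if `t` is zero or a collision
time, the energy is conserved and the virial dominates its free-flow value as well. -/
def DominatesFreeFlow (t : ℝ) : Prop :=
  ∑ k, ‖Z.x k 0 + t • Z.v k 0‖ ^ 2 ≤ ∑ k, ‖Z.x k t‖ ^ 2 ∧
    (t = 0 ∨ t ∈ Z.col → ∑ k, ‖Z.v k t‖ ^ 2 = ∑ k, ‖Z.v k 0‖ ^ 2 ∧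
      ∑ k, ⟪Z.x k 0, Z.v k 0⟫_ℝ + t * ∑ k, ‖Z.v k 0‖ ^ 2 ≤ ∑ k, ⟪Z.x k t, Z.v k t⟫_ℝ)

variable {Z} in
/-- Domination of the free flow propagates across a collision-free interval starting at time zero
or at a collision time. -/
lemma DominatesFreeFlow.step (hε : 0 < ε) {a b : ℝ} (h : Z.DominatesFreeFlow a)
    (ha : a = 0 ∨ a ∈ Z.col) (ha0 : 0 ≤ a) (hb : b ≤ T) (hab : a < b)
    (hfree : ∀ τ ∈ Z.col, τ ∉ Set.Ioo a b) : Z.DominatesFreeFlow b := by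
  obtain ⟨hI, h⟩ := h
  obtain ⟨hE, hJ⟩ := h ha
  have hx := Z.position_eq_free ha0 hb hab hfree
  refine ⟨?_, fun hb' => ?_⟩
  · rw [sum_norm_add_smul_sq] at hI
    simp only [hx, sum_norm_add_smul_sq, hE]
    nlinarith [mul_le_mul_of_nonneg_left hJ (sub_nonneg.2 hab.le)]
  · have hcol : b ∈ Z.col := hb'.resolve_left (ha0.trans_lt hab).ne'
    obtain ⟨hEb, hJb⟩ := Z.energy_eq_and_virial_le hε ha0 hab hfree hcol
    refine ⟨hEb.trans hE, le_trans ?_ hJb⟩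
    have hvirial : ∑ k, ⟪Z.x k b, Z.v k a⟫_ℝ =
        ∑ k, ⟪Z.x k a, Z.v k a⟫_ℝ + (b - a) * ∑ k, ‖Z.v k a‖ ^ 2 := by
      simp only [hx, inner_add_left, real_inner_smul_left, real_inner_self_eq_norm_sq,
        Finset.sum_add_distrib, Finset.mul_sum]
    rw [hvirial, hE]
    linarith

lemma dominatesFreeFlow (hε : 0 < ε) {t : ℝ} (ht : t ∈ Set.Icc 0 T) :
    Z.DominatesFreeFlow t := by
  have hzero : Z.DominatesFreeFlow 0 := ⟨by simp, fun _ => by simp⟩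
  induction hn : (Z.col.filter (· < t)).card using Nat.strong_induction_on generalizing t with
  | _ n ih =>
  rcases ht.1.eq_or_lt with rfl | ht0
  · exact hzero
  rcases (Z.col.filter (· < t)).eq_empty_or_nonempty with hempty | hne
  · refine hzero.step hε (Or.inl rfl) le_rfl ht.2 ht0 fun τ hτ hmem => ?_
    exact Finset.notMem_empty τ (hempty ▸ Finset.mem_filter.2 ⟨hτ, hmem.2⟩)
  · obtain ⟨hcol, hlt⟩ := Finset.mem_filter.1 (Finset.max'_mem _ hne)
    have hmax : ∀ τ ∈ Z.col.filter (· < t), τ ≤ (Z.col.filter (· < t)).max' hne :=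
      fun τ hτ => Finset.le_max' _ τ hτ
    generalize (Z.col.filter (· < t)).max' hne = a at *
    have ha := Z.col_mem a hcol
    have hcard : (Z.col.filter (· < a)).card < n := by
      rw [← hn]
      refine Finset.card_lt_card (Finset.ssubset_iff_of_subset ?_ |>.2
        ⟨a, Finset.mem_filter.2 ⟨hcol, hlt⟩, by simp⟩)
      exact Finset.monotone_filter_right _ fun r _ hr => lt_trans hr hlt
    refine (ih _ hcard ⟨ha.1.le, ha.2.le⟩ rfl).step hε (Or.inr hcol) ha.1.le ht.2 hlt
      fun τ hτ hmem => ?_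
    exact (hmax τ (Finset.mem_filter.2 ⟨hτ, hmem.2⟩)).not_gt hmem.1

end HardSphereTrajectory

/-- **Dispersive comparison for the hard-sphere flow (Lemma 3.2, forward-in-time form).**
Along any hard-sphere trajectory, the moment of inertia dominates that of the free flow
started from the same initial configuration:
`(1/2)∑ |xᵢ(t)|² ≥ (1/2)∑ |xᵢ(0) + t vᵢ(0)|²`. -/
theorem hard_sphere_dispersive_comparison
    (d s : ℕ) (hd : 2 ≤ d) (hs : 1 ≤ s) (ε T : ℝ) (hε : 0 < ε) (hT : 0 < T)
    (Z : HardSphereTrajectory d s ε T) :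
    ∀ t ∈ Set.Icc (0:ℝ) T,
      (1/2) * ∑ i, ‖Z.x i 0 + t • Z.v i 0‖ ^ 2 ≤ (1/2) * ∑ i, ‖Z.x i t‖ ^ 2 := by
  intro t ht
  exact mul_le_mul_of_nonneg_left (Z.dominatesFreeFlow hε ht).1 (by norm_num)
end

section
/- Reflection map on the sphere (Lemma 9.1). Fix d ≥ 2 and v ∈ ℝ^d with v ≠ 0. For ω ∈ S^{d−1} define u_ω = |v|^{−1} (2 ω (ω·v) − v). Then u_ω ∈ S^{d−1} for every ω ∈ S^{d−1}; moreover, if S^{d−1}_v = {ω ∈ S^{d−1} : ω·v > 0}, then the map ω ↦ u_ω restricts to a diffeomorphism from S^{d−1}_v onto S^{d−1} \ {−|v|^{−1} v}. -/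
open scoped InnerProductSpace

section ReflectionMap

variable {E : Type*} [NormedAddCommGroup E] [InnerProductSpace ℝ E]

/-- Twice the projection onto a unit vector minus the identity is an isometry. -/
lemma norm_two_mul_inner_smul_sub {ω : E} (hω : ‖ω‖ = 1) (v : E) :
    ‖(2 * ⟪ω, v⟫_ℝ) • ω - v‖ = ‖v‖ := by
  rw [← sq_eq_sq₀ (norm_nonneg _) (norm_nonneg _), norm_sub_sq_real, norm_smul, hω,
    real_inner_smul_left, mul_one, Real.norm_eq_abs, sq_abs]
  ring

lemma inv_norm_smul_reflection_add (v ω : E) :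
    ‖v‖⁻¹ • ((2 * ⟪ω, v⟫_ℝ) • ω - v) + ‖v‖⁻¹ • v = (‖v‖⁻¹ * (2 * ⟪ω, v⟫_ℝ)) • ω := by
  rw [← smul_add, sub_add_cancel, smul_smul]

lemma inv_norm_smul_smul_of_pos {ω : E} (hω : ‖ω‖ = 1) {c : ℝ} (hc : 0 < c) :
    ‖c • ω‖⁻¹ • (c • ω) = ω := by
  rw [norm_smul, hω, mul_one, Real.norm_of_nonneg hc.le, inv_smul_smul₀ hc.ne']

/-- A unit vector `u` satisfies `⟪u + v/‖v‖, v⟫ = ‖v‖ ‖u + v/‖v‖‖² / 2`. -/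
lemma inner_add_inv_norm_smul {u v : E} (hu : ‖u‖ = 1) (hv : v ≠ 0) :
    2 * ⟪u + ‖v‖⁻¹ • v, v⟫_ℝ = ‖v‖ * ‖u + ‖v‖⁻¹ • v‖ ^ 2 := by
  have hv' : ‖v‖ ≠ 0 := norm_ne_zero_iff.2 hv
  rw [norm_add_sq_real, norm_smul, norm_inv, norm_norm, inv_mul_cancel₀ hv', hu,
    inner_add_left, real_inner_smul_left, real_inner_smul_right, real_inner_self_eq_norm_sq]
  field_simp
  ring

/-- The map `u ↦ (u + v/‖v‖)/‖u + v/‖v‖‖` is a right inverse of the reflection map. -/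
lemma reflection_inv_norm_smul_add {u v : E} (hu : ‖u‖ = 1) (hv : v ≠ 0)
    (huv : u + ‖v‖⁻¹ • v ≠ 0) :
    ‖v‖⁻¹ • ((2 * ⟪‖u + ‖v‖⁻¹ • v‖⁻¹ • (u + ‖v‖⁻¹ • v), v⟫_ℝ) •
      (‖u + ‖v‖⁻¹ • v‖⁻¹ • (u + ‖v‖⁻¹ • v)) - v) = u := by
  have hv' : ‖v‖ ≠ 0 := norm_ne_zero_iff.2 hv
  have hw : ‖u + ‖v‖⁻¹ • v‖ ≠ 0 := norm_ne_zero_iff.2 huv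
  rw [real_inner_smul_left, smul_smul, mul_left_comm,
    inner_add_inv_norm_smul hu hv]
  have hcoef : ‖u + ‖v‖⁻¹ • v‖⁻¹ * (‖v‖ * ‖u + ‖v‖⁻¹ • v‖ ^ 2) * ‖u + ‖v‖⁻¹ • v‖⁻¹
      = ‖v‖ := by
    rw [mul_right_comm, mul_left_comm, pow_two, ← mul_inv, inv_mul_cancel₀ (mul_ne_zero hw hw),
      mul_one]
  rw [hcoef, smul_add, smul_inv_smul₀ hv', add_sub_cancel_right, inv_smul_smul₀ hv']

end ReflectionMap

/-- **Reflection map on the sphere (Lemma 9.1).** For `v ≠ 0`, the map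
`ω ↦ u_ω = ‖v‖⁻¹ (2 ω (ω·v) − v)` sends the unit sphere to the unit sphere, and it
restricts to a diffeomorphism from the open hemisphere `{ω : ω·v > 0}` onto the sphere
with the antipode `−v/‖v‖` removed: it is a bijection between these sets, it is smooth,
and its inverse `u ↦ (u + v/‖v‖)/‖u + v/‖v‖‖` is smooth away from `−v/‖v‖`. -/
theorem reflection_map_sphere_diffeomorphism
    (d : ℕ) (hd : 2 ≤ d) (v : EuclideanSpace ℝ (Fin d)) (hv : v ≠ 0) :
    (∀ ω : EuclideanSpace ℝ (Fin d), ‖ω‖ = 1 →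
        ‖‖v‖⁻¹ • ((2 * ⟪ω, v⟫_ℝ) • ω - v)‖ = 1) ∧
    Set.BijOn (fun ω : EuclideanSpace ℝ (Fin d) => ‖v‖⁻¹ • ((2 * ⟪ω, v⟫_ℝ) • ω - v))
      {ω | ‖ω‖ = 1 ∧ 0 < ⟪ω, v⟫_ℝ}
      (Metric.sphere (0 : EuclideanSpace ℝ (Fin d)) 1 \ {-(‖v‖⁻¹ • v)}) ∧
    ContDiff ℝ (⊤ : ℕ∞)
      (fun ω : EuclideanSpace ℝ (Fin d) => ‖v‖⁻¹ • ((2 * ⟪ω, v⟫_ℝ) • ω - v)) ∧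
    ContDiffOn ℝ (⊤ : ℕ∞)
      (fun u : EuclideanSpace ℝ (Fin d) => ‖u + ‖v‖⁻¹ • v‖⁻¹ • (u + ‖v‖⁻¹ • v))
      {u | u ≠ -(‖v‖⁻¹ • v)} ∧
    ∀ ω : EuclideanSpace ℝ (Fin d), ‖ω‖ = 1 → 0 < ⟪ω, v⟫_ℝ →
      ‖(‖v‖⁻¹ • ((2 * ⟪ω, v⟫_ℝ) • ω - v)) + ‖v‖⁻¹ • v‖⁻¹ •
          ((‖v‖⁻¹ • ((2 * ⟪ω, v⟫_ℝ) • ω - v)) + ‖v‖⁻¹ • v) = ω := by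
  have hv' : 0 < ‖v‖ := norm_pos_iff.2 hv
  have hnorm (ω : EuclideanSpace ℝ (Fin d)) (hω : ‖ω‖ = 1) :
      ‖‖v‖⁻¹ • ((2 * ⟪ω, v⟫_ℝ) • ω - v)‖ = 1 := by
    rw [norm_smul, norm_two_mul_inner_smul_sub hω, norm_inv, norm_norm,
      inv_mul_cancel₀ hv'.ne']
  have hleft (ω : EuclideanSpace ℝ (Fin d)) (hω : ‖ω‖ = 1) (hpos : 0 < ⟪ω, v⟫_ℝ) :
      ‖(‖v‖⁻¹ • ((2 * ⟪ω, v⟫_ℝ) • ω - v)) + ‖v‖⁻¹ • v‖⁻¹ •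
          ((‖v‖⁻¹ • ((2 * ⟪ω, v⟫_ℝ) • ω - v)) + ‖v‖⁻¹ • v) = ω := by
    rw [inv_norm_smul_reflection_add]
    exact inv_norm_smul_smul_of_pos hω (by positivity)
  have hinner : ContDiff ℝ (⊤ : ℕ∞) (fun ω : EuclideanSpace ℝ (Fin d) => ⟪ω, v⟫_ℝ) :=
    contDiff_id.inner ℝ contDiff_const
  refine ⟨hnorm, ⟨?_, ?_, ?_⟩, by fun_prop, ?_, hleft⟩
  · rintro ω ⟨hω, hpos⟩
    refine ⟨mem_sphere_zero_iff_norm.2 (hnorm ω hω), fun h => ?_⟩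
    have h0 := hleft ω hω hpos
    rw [add_eq_zero_iff_eq_neg.2 h, smul_zero] at h0
    simp [← h0] at hω
  · rintro ω₁ ⟨h₁, hpos₁⟩ ω₂ ⟨h₂, hpos₂⟩ h
    dsimp only at h
    rw [← hleft ω₁ h₁ hpos₁, h, hleft ω₂ h₂ hpos₂]
  · rintro u ⟨hu, hne⟩
    have hu' : ‖u‖ = 1 := mem_sphere_zero_iff_norm.1 hu
    have hw : u + ‖v‖⁻¹ • v ≠ 0 := fun h => hne (add_eq_zero_iff_eq_neg.1 h)
    have hw' : 0 < ‖u + ‖v‖⁻¹ • v‖ := norm_pos_iff.2 hw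
    refine ⟨‖u + ‖v‖⁻¹ • v‖⁻¹ • (u + ‖v‖⁻¹ • v), ⟨?_, ?_⟩,
      reflection_inv_norm_smul_add hu' hv hw⟩
    · rw [norm_smul, norm_inv, norm_norm, inv_mul_cancel₀ hw'.ne']
    · rw [real_inner_smul_left]
      have hpos : 0 < 2 * ⟪u + ‖v‖⁻¹ • v, v⟫_ℝ := by
        rw [inner_add_inv_norm_smul hu' hv]
        positivity
      exact mul_pos (inv_pos.2 hw') (pos_of_mul_pos_right hpos zero_le_two)
  · have hne (u : EuclideanSpace ℝ (Fin d)) (hu : u ∈ {u | u ≠ -(‖v‖⁻¹ • v)}) :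
        u + ‖v‖⁻¹ • v ≠ 0 := fun h => hu (add_eq_zero_iff_eq_neg.1 h)
    have hadd : ContDiffOn ℝ (⊤ : ℕ∞) (fun u : EuclideanSpace ℝ (Fin d) => u + ‖v‖⁻¹ • v)
        {u | u ≠ -(‖v‖⁻¹ • v)} := by fun_prop
    exact ((hadd.norm ℝ hne).inv fun u hu => norm_ne_zero_iff.2 (hne u hu)).smul hadd
end

section
/- Spherical measure of a cylinder (Lemma 9.2). Let d ≥ 2. There exists a constant C_d > 0, depending only on d, such that for every line L ⊂ ℝ^d and every ρ > 0, writing 𝒞_ρ = {u ∈ ℝ^d : dist(u, L) ≤ ρ} for the solid cylinder of radius ρ around L, the surface measure of S^{d−1} ∩ 𝒞_ρ satisfies ∫_{S^{d−1}} 1_{ω ∈ 𝒞_ρ} dω ≤ C_d ρ^{(d−1)/2}. The constant C_d does not depend on the choice of the line L. -/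
open MeasureTheory

section SphericalCaps

open Metric Module Set
open scoped Pointwise

variable {E : Type*} [NormedAddCommGroup E] [NormedSpace ℝ E]

/-- The cone over a spherical cap of radius `r` is covered by about `1 / r` balls of radius `2 * r`
centred on the axis of the cone. -/
lemma cone_cap_subset_iUnion_closedBall (x : sphere (0 : E) 1) {r : ℝ} (hr : 0 < r) :
    Ioo (0 : ℝ) 1 • ((↑) '' (closedBall x r : Set (sphere (0 : E) 1)) : Set E) ⊆
      ⋃ k ∈ Finset.range (⌊1 / r⌋₊ + 1), closedBall (((k : ℝ) * r) • (x : E)) (2 * r) := by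
  rintro _ ⟨s, ⟨hs0, hs1⟩, _, ⟨y, hy, rfl⟩, rfl⟩
  have hle : (⌊s / r⌋₊ : ℝ) ≤ s / r := Nat.floor_le (by positivity)
  have hlt : s / r < ⌊s / r⌋₊ + 1 := Nat.lt_floor_add_one _
  rw [le_div_iff₀ hr] at hle
  rw [div_lt_iff₀ hr] at hlt
  have hk : ⌊s / r⌋₊ < ⌊1 / r⌋₊ + 1 :=
    Nat.lt_succ_of_le (Nat.floor_le_floor (by gcongr))
  refine mem_iUnion₂.2 ⟨⌊s / r⌋₊, Finset.mem_range.2 hk, ?_⟩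
  set k : ℝ := (⌊s / r⌋₊ : ℝ)
  have hx : ‖(x : E)‖ = 1 := norm_eq_of_mem_sphere x
  have hxy : ‖(y : E) - x‖ ≤ r := by
    rw [← dist_eq_norm]
    exact hy
  have hsplit : s • (y : E) - (k * r) • (x : E) = s • ((y : E) - x) + (s - k * r) • (x : E) := by
    module
  rw [mem_closedBall, dist_eq_norm]
  calc ‖s • (y : E) - (k * r) • (x : E)‖
      ≤ ‖s • ((y : E) - x)‖ + ‖(s - k * r) • (x : E)‖ := by
        rw [hsplit]
        exact norm_add_le _ _
    _ = s * ‖(y : E) - x‖ + (s - k * r) := by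
        rw [norm_smul, norm_smul, hx, Real.norm_of_nonneg hs0.le,
          Real.norm_of_nonneg (sub_nonneg.2 hle), mul_one]
    _ ≤ 1 * r + r := by gcongr; linarith
    _ = 2 * r := by ring

/-- The surface measure of a spherical cap of radius `r` is at most a constant times
`r ^ (dim - 1)`. -/
lemma exists_toSphere_closedBall_le [MeasurableSpace E] [BorelSpace E] [FiniteDimensional ℝ E]
    [Nontrivial E] (μ : Measure E) [μ.IsAddHaarMeasure] :
    ∃ C : ℝ, 0 < C ∧ ∀ (x : sphere (0 : E) 1) (r : ℝ), 0 < r →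
      μ.toSphere (closedBall x r) ≤ ENNReal.ofReal (C * r ^ (finrank ℝ E - 1)) := by
  obtain ⟨n, hn⟩ : ∃ n, finrank ℝ E = n + 1 :=
    Nat.exists_eq_succ_of_ne_zero finrank_pos.ne'
  set V : ℝ := μ.real (ball (0 : E) 1)
  set T : ℝ := μ.toSphere.real univ
  have hV : 0 ≤ V := measureReal_nonneg
  have hT : 0 ≤ T := measureReal_nonneg
  refine ⟨T + (n + 1) * (2 * 2 ^ (n + 1) * V) + 1, by positivity, fun x r hr ↦ ?_⟩
  simp only [hn, Nat.add_sub_cancel]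
  rcases le_or_gt r 1 with hr1 | hr1
  · have hball (y : E) :
        μ (closedBall y (2 * r)) = ENNReal.ofReal ((2 * r) ^ (n + 1) * V) := by
      rw [Measure.addHaar_closedBall _ _ (by positivity), hn, ENNReal.ofReal_mul (by positivity),
        ofReal_measureReal measure_ball_lt_top.ne]
    have hfloor : (⌊1 / r⌋₊ : ℝ) + 1 ≤ 2 / r := by
      have h₁ : (⌊1 / r⌋₊ : ℝ) ≤ 1 / r := Nat.floor_le (by positivity)
      have h₂ : 1 ≤ 1 / r := (one_le_div hr).2 hr1
      calc (⌊1 / r⌋₊ : ℝ) + 1 ≤ 1 / r + 1 / r := by gcongr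
        _ = 2 / r := by ring
    have hcone : μ (Ioo (0 : ℝ) 1 • ((↑) '' (closedBall x r : Set (sphere (0 : E) 1)) : Set E)) ≤
        ENNReal.ofReal (2 * 2 ^ (n + 1) * V * r ^ n) := by
      calc _ ≤ μ (⋃ k ∈ Finset.range (⌊1 / r⌋₊ + 1),
              closedBall (((k : ℝ) * r) • (x : E)) (2 * r)) :=
            measure_mono (cone_cap_subset_iUnion_closedBall x hr)
        _ ≤ ∑ k ∈ Finset.range (⌊1 / r⌋₊ + 1),
              μ (closedBall (((k : ℝ) * r) • (x : E)) (2 * r)) :=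
            measure_biUnion_finset_le _ _
        _ = ENNReal.ofReal (((⌊1 / r⌋₊ : ℝ) + 1) * ((2 * r) ^ (n + 1) * V)) := by
            simp only [hball, Finset.sum_const, Finset.card_range, nsmul_eq_mul]
            rw [← Nat.cast_add_one, ENNReal.ofReal_mul (Nat.cast_nonneg _), ENNReal.ofReal_natCast]
        _ ≤ ENNReal.ofReal (2 / r * ((2 * r) ^ (n + 1) * V)) := by gcongr
        _ = ENNReal.ofReal (2 * 2 ^ (n + 1) * V * r ^ n) := by
            congr 1
            field_simp
            ring
    rw [Measure.toSphere_apply' _ measurableSet_closedBall, hn]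
    calc ((n + 1 : ℕ) : ENNReal) *
          μ (Ioo (0 : ℝ) 1 • ((↑) '' (closedBall x r : Set (sphere (0 : E) 1)) : Set E))
        ≤ ENNReal.ofReal ((n + 1 : ℕ) : ℝ) * ENNReal.ofReal (2 * 2 ^ (n + 1) * V * r ^ n) := by
          rw [ENNReal.ofReal_natCast]
          gcongr
      _ = ENNReal.ofReal ((n + 1) * (2 * 2 ^ (n + 1) * V) * r ^ n) := by
          rw [← ENNReal.ofReal_mul (by positivity), ← mul_assoc, Nat.cast_add_one]
      _ ≤ _ := by
          gcongr
          linarith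
  · calc μ.toSphere (closedBall x r) ≤ μ.toSphere univ := measure_mono (subset_univ _)
      _ = ENNReal.ofReal T := (ofReal_measureReal (measure_ne_top _ _)).symm
      _ ≤ _ := by
          gcongr
          have hpow : 1 ≤ r ^ n := one_le_pow₀ hr1.le
          have hrest : 0 ≤ (n + 1 : ℝ) * (2 * 2 ^ (n + 1) * V) := by positivity
          nlinarith

end SphericalCaps

section Cylinder

open Metric Set
open scoped RealInnerProductSpace

variable {E : Type*} [NormedAddCommGroup E] [InnerProductSpace ℝ E]

lemma norm_sq_eq_inner_sq_add_norm_sub_sq {e : E} (he : ‖e‖ = 1) (x : E) :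
    ‖x‖ ^ 2 = ⟪e, x⟫ ^ 2 + ‖x - ⟪e, x⟫ • e‖ ^ 2 := by
  rw [norm_sub_sq_real, norm_smul, he, inner_smul_right, real_inner_comm, mul_one, Real.norm_eq_abs,
    sq_abs]
  ring

/-- A point near the line through `p` with direction `u` has its component orthogonal to `u` near
that of `p`. -/
lemma norm_orthogonal_component_sub_lt {e u p x : E} {c ρ : ℝ} (he : ‖e‖ = 1) (hu : u = c • e)
    (hρ : 0 < ρ) (hx : infDist x {z | ∃ t : ℝ, z = p + t • u} ≤ ρ) :
    ‖(x - ⟪e, x⟫ • e) - (p - ⟪e, p⟫ • e)‖ < 2 * ρ := by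
  have hne : {z : E | ∃ t : ℝ, z = p + t • u}.Nonempty := ⟨p, 0, by simp⟩
  obtain ⟨_, ⟨t, rfl⟩, ht⟩ :=
    (infDist_lt_iff hne).1 (hx.trans_lt (by linarith : ρ < 2 * ρ))
  rw [dist_eq_norm] at ht
  refine lt_of_le_of_lt ?_ ht
  set v := x - (p + t • u) with hv
  have hxv : x = p + t • u + v := by rw [hv]; abel
  have hee : ⟪e, e⟫ = 1 := by rw [real_inner_self_eq_norm_sq, he, one_pow]
  have heq : (x - ⟪e, x⟫ • e) - (p - ⟪e, p⟫ • e) = v - ⟪e, v⟫ • e := by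
    rw [hxv, hu]
    simp only [inner_add_right, inner_smul_right, hee]
    module
  rw [heq]
  refine (sq_le_sq₀ (norm_nonneg _) (norm_nonneg _)).1 ?_
  rw [norm_sq_eq_inner_sq_add_norm_sub_sq he v]
  nlinarith [sq_nonneg ⟪e, v⟫]

/-- Two unit vectors in a cylinder of radius `ρ`, on the same side of the hyperplane orthogonal to
its axis, are within `5 * √ρ` of each other. -/
lemma dist_le_of_mem_cylinder {e u p x y : E} {c ρ : ℝ} (he : ‖e‖ = 1) (hu : u = c • e)
    (hρ : 0 < ρ) (hx1 : ‖x‖ = 1) (hy1 : ‖y‖ = 1)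
    (hx : infDist x {z | ∃ t : ℝ, z = p + t • u} ≤ ρ)
    (hy : infDist y {z | ∃ t : ℝ, z = p + t • u} ≤ ρ)
    (hxy : 0 ≤ ⟪e, x⟫ * ⟪e, y⟫) : dist x y ≤ 5 * √ρ := by
  have hs : √ρ ^ 2 = ρ := Real.sq_sqrt hρ.le
  rw [dist_eq_norm]
  rcases le_or_gt ρ 1 with hρ1 | hρ1
  · have hQx := norm_orthogonal_component_sub_lt he hu hρ hx
    have hQy := norm_orthogonal_component_sub_lt he hu hρ hy
    have hnx := norm_sq_eq_inner_sq_add_norm_sub_sq he x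
    have hny := norm_sq_eq_inner_sq_add_norm_sub_sq he y
    have hn := norm_sq_eq_inner_sq_add_norm_sub_sq he (x - y)
    have hQ : (x - y) - ⟪e, x - y⟫ • e = (x - ⟪e, x⟫ • e) - (y - ⟪e, y⟫ • e) := by
      rw [inner_sub_right]
      module
    rw [hQ, inner_sub_right] at hn
    rw [hx1] at hnx
    rw [hy1] at hny
    set X := x - ⟪e, x⟫ • e
    set Y := y - ⟪e, y⟫ • e
    set P := p - ⟪e, p⟫ • e
    set a := ⟪e, x⟫
    set b := ⟪e, y⟫
    have hXY : ‖X - Y‖ ≤ 4 * ρ := by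
      have h := norm_sub_le (X - P) (Y - P)
      rw [sub_sub_sub_cancel_right] at h
      linarith
    have hdiff : |‖X‖ - ‖Y‖| ≤ 4 * ρ := (abs_norm_sub_norm_le X Y).trans hXY
    have hX1 : ‖X‖ ≤ 1 := by nlinarith [norm_nonneg X, sq_nonneg a]
    have hY1 : ‖Y‖ ≤ 1 := by nlinarith [norm_nonneg Y, sq_nonneg b]
    have habs : |a ^ 2 - b ^ 2| ≤ 8 * ρ := by
      have : a ^ 2 - b ^ 2 = -((‖X‖ - ‖Y‖) * (‖X‖ + ‖Y‖)) := by linarith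
      rw [this, abs_neg, abs_mul, abs_of_nonneg (by positivity : 0 ≤ ‖X‖ + ‖Y‖)]
      calc _ ≤ (4 * ρ) * (1 + 1) := by gcongr
        _ = 8 * ρ := by ring
    have hab : (a - b) ^ 2 ≤ 8 * ρ := by
      have hle : |a - b| ≤ |a + b| := sq_le_sq.1 (by nlinarith)
      calc (a - b) ^ 2 = |a - b| * |a - b| := by rw [← sq, sq_abs]
        _ ≤ |a - b| * |a + b| := by gcongr
        _ = |a ^ 2 - b ^ 2| := by rw [← abs_mul]; ring_nf
        _ ≤ 8 * ρ := habs
    have hXYsq : ‖X - Y‖ ^ 2 ≤ 16 * ρ := by nlinarith [norm_nonneg (X - Y)]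
    refine (sq_le_sq₀ (norm_nonneg _) (by positivity)).1 ?_
    nlinarith
  · have h1 : 1 ≤ √ρ := Real.one_le_sqrt.2 hρ1.le
    linarith [norm_sub_le x y]

/-- A subset of the unit sphere on which all distances are at most `r` has surface measure at most
that of a cap of radius `r`. -/
lemma toSphere_le_of_dist_le [MeasurableSpace E] {μ : Measure E} {A : Set (sphere (0 : E) 1)}
    {r : ℝ} {B : ENNReal} (hcap : ∀ x : sphere (0 : E) 1, μ.toSphere (closedBall x r) ≤ B)
    (hA : ∀ x ∈ A, ∀ y ∈ A, dist (x : E) y ≤ r) : μ.toSphere A ≤ B := by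
  rcases A.eq_empty_or_nonempty with rfl | ⟨x, hx⟩
  · simp
  · exact (measure_mono fun y hy ↦ hA y hy x hx).trans (hcap x)

end Cylinder

/-- **Spherical measure of a cylinder (Lemma 9.2).** There is a constant `C_d > 0`,
depending only on the dimension `d ≥ 2`, such that for every line `L ⊂ ℝ^d`
(parametrized as `{p + t • u : t ∈ ℝ}` with `u ≠ 0`) and every `ρ > 0`, the surface
measure of the portion of the unit sphere lying within distance `ρ` of `L` is at most
`C_d ρ^((d−1)/2)`. -/
theorem sphere_cylinder_measure_bound
    (d : ℕ) (hd : 2 ≤ d) :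
    ∃ C : ℝ, 0 < C ∧
      ∀ (p u : EuclideanSpace ℝ (Fin d)), u ≠ 0 → ∀ ρ : ℝ, 0 < ρ →
        (volume : Measure (EuclideanSpace ℝ (Fin d))).toSphere
            {ω : Metric.sphere (0 : EuclideanSpace ℝ (Fin d)) 1 |
              Metric.infDist (ω : EuclideanSpace ℝ (Fin d))
                {x : EuclideanSpace ℝ (Fin d) | ∃ t : ℝ, x = p + t • u} ≤ ρ}
          ≤ ENNReal.ofReal (C * ρ ^ (((d : ℝ) - 1) / 2)) := by
  have : Nonempty (Fin d) := ⟨⟨0, by omega⟩⟩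
  obtain ⟨C, hC, hcap⟩ :=
    exists_toSphere_closedBall_le (volume : Measure (EuclideanSpace ℝ (Fin d)))
  rw [finrank_euclideanSpace_fin] at hcap
  refine ⟨2 * (C * 5 ^ (d - 1)), by positivity, fun p u hu ρ hρ ↦ ?_⟩
  have hu' : ‖u‖ ≠ 0 := norm_ne_zero_iff.2 hu
  set e : EuclideanSpace ℝ (Fin d) := ‖u‖⁻¹ • u
  have he : ‖e‖ = 1 := by
    rw [norm_smul, norm_inv, norm_norm, inv_mul_cancel₀ hu']
  have hue : u = ‖u‖ • e := (smul_inv_smul₀ hu' u).symm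
  set A := {ω : Metric.sphere (0 : EuclideanSpace ℝ (Fin d)) 1 |
    Metric.infDist (ω : EuclideanSpace ℝ (Fin d))
      {x : EuclideanSpace ℝ (Fin d) | ∃ t : ℝ, x = p + t • u} ≤ ρ}
  have hsplit : A ⊆ {ω ∈ A | 0 ≤ inner ℝ e ω.1} ∪ {ω ∈ A | inner ℝ e ω.1 ≤ 0} :=
    fun ω hω ↦ (le_total 0 (inner ℝ e ω.1)).imp (fun h ↦ ⟨hω, h⟩) (fun h ↦ ⟨hω, h⟩)
  have hB := fun x ↦ hcap x (5 * √ρ) (by positivity)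
  have hpos := toSphere_le_of_dist_le (A := {ω ∈ A | 0 ≤ inner ℝ e ω.1}) hB
    fun x hx y hy ↦ dist_le_of_mem_cylinder he hue hρ (norm_eq_of_mem_sphere x)
      (norm_eq_of_mem_sphere y) hx.1 hy.1 (mul_nonneg hx.2 hy.2)
  have hneg := toSphere_le_of_dist_le (A := {ω ∈ A | inner ℝ e ω.1 ≤ 0}) hB
    fun x hx y hy ↦ dist_le_of_mem_cylinder he hue hρ (norm_eq_of_mem_sphere x)
      (norm_eq_of_mem_sphere y) hx.1 hy.1 (mul_nonneg_of_nonpos_of_nonpos hx.2 hy.2)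
  have hpow : √ρ ^ (d - 1) = ρ ^ (((d : ℝ) - 1) / 2) := by
    rw [Real.sqrt_eq_rpow, ← Real.rpow_mul_natCast hρ.le, Nat.cast_sub (by omega), Nat.cast_one]
    ring_nf
  refine (measure_mono hsplit).trans ((measure_union_le _ _).trans ((add_le_add hpos hneg).trans ?_))
  rw [← ENNReal.ofReal_add (by positivity) (by positivity), mul_pow, hpow]
  exact ENNReal.ofReal_le_ofReal (by linarith)
end
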